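/- Let n be a positive integer with n ≡ 1 (mod 4) and let a be an indeterminate. For a = q^{2n} or a = q^{−2n}, the terminating sum over k from 0 to (n−1)/4 of [8k+1]_{q^2} · [8k+1]^2 · (q^2;q^8)_k^2 (q^{2+2n};q^8)_k (q^{2−2n};q^8)_k / ((q^8;q^8)_k^2 (q^{8+2n};q^8)_k (q^{8−2n};q^8)_k) · q^{−4k} equals [n]_{q^2} · ((q^4;q^8)_{(n−1)/4}/(q^8;q^8)_{(n−1)/4}) · q^{−(n−1)/2} · (1 − (1−q^{2+2n})(1−q^{2−2n}) / ((1−q)^2 (1+q^2))). -/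

import Mathlib

open Polynomial Finset

/-- The q-shifted factorial `(x; r)_k = (1-x)(1-x r)⋯(1-x r^(k-1))`. -/
noncomputable def qPoch {F : Type*} [Field F] (x r : F) (k : ℕ) : F :=
  ∏ i ∈ Finset.range k, (1 - x * r ^ i)

/-- The q-integer `[z] = (1-q^z)/(1-q)` (for an arbitrary integer `z`). -/
noncomputable def qInt {F : Type*} [Field F] (q : F) (z : ℤ) : F :=
  (1 - q ^ z) / (1 - q)

/-- The rational function `x ∈ ℚ(q)` is ≡ 0 modulo the polynomial `M`:
its numerator in lowest terms is divisible by `M`, i.e. `x = M·f/g` with `g` coprime to `M`. -/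
def ratCongr (M : Polynomial ℚ) (x : RatFunc ℚ) : Prop :=
  ∃ f g : Polynomial ℚ, IsCoprime M g ∧
    x * algebraMap (Polynomial ℚ) (RatFunc ℚ) g =
      algebraMap (Polynomial ℚ) (RatFunc ℚ) M * algebraMap (Polynomial ℚ) (RatFunc ℚ) f


section QPoch

variable {F : Type*} [Field F]

theorem qPoch_zero (x r : F) : qPoch x r 0 = 1 := by
  simp [qPoch]

theorem qPoch_succ (x r : F) (k : ℕ) : qPoch x r (k + 1) = qPoch x r k * (1 - x * r ^ k) :=
  Finset.prod_range_succ _ _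

theorem qPoch_succ_left (x r : F) (k : ℕ) :
    qPoch x r (k + 1) = (1 - x) * qPoch (x * r) r k := by
  simp only [qPoch, Finset.prod_range_succ', pow_zero, mul_one]
  rw [mul_comm]
  congr 1
  exact Finset.prod_congr rfl fun i _ => by rw [pow_succ']; ring

theorem one_sub_mul_qPoch (x r : F) (k : ℕ) :
    (1 - x) * qPoch (x * r) r k = qPoch x r k * (1 - x * r ^ k) := by
  rw [← qPoch_succ_left, qPoch_succ]

theorem qPoch_ne_zero {x r : F} (h : ∀ i : ℕ, 1 - x * r ^ i ≠ 0) (k : ℕ) : qPoch x r k ≠ 0 :=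
  Finset.prod_ne_zero_iff.mpr fun i _ => h i

theorem qPoch_inv_pow_succ_self {r : F} (hr : r ≠ 0) (N : ℕ) :
    qPoch (r ^ N)⁻¹ r (N + 1) = 0 := by
  rw [qPoch_succ, inv_mul_cancel₀ (pow_ne_zero _ hr), sub_self, mul_zero]

/-- Reversal of the order of the factors, stated as a ratio. -/
theorem qPoch_reverse {r x y : F} (hr : r ≠ 0) (hx : x ≠ 0) (hy : y ≠ 0) (N : ℕ) :
    qPoch (r * (x * r ^ N)⁻¹) r N * x ^ N * qPoch y r N =
      qPoch x r N * y ^ N * qPoch (r * (y * r ^ N)⁻¹) r N := by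
  induction N with
  | zero => simp [qPoch_zero]
  | succ N ih =>
    have shift (t : F) : r * (t * r ^ (N + 1))⁻¹ * r = r * (t * r ^ N)⁻¹ := by
      rw [pow_succ, mul_inv, mul_inv, mul_inv]; field_simp
    have head (t : F) (ht : t ≠ 0) :
        t * (1 - r * (t * r ^ (N + 1))⁻¹) = -(1 - t * r ^ N) * (r ^ N)⁻¹ := by
      field_simp; ring
    rw [qPoch_succ_left _ _ N, qPoch_succ_left (r * (y * r ^ (N + 1))⁻¹) _ N, shift, shift,
      qPoch_succ, qPoch_succ]
    linear_combination (x * (1 - r * (x * r ^ (N + 1))⁻¹) * (1 - y * r ^ N)) * ih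
      + (qPoch x r N * y ^ N * qPoch (r * (y * r ^ N)⁻¹) r N) *
        ((1 - y * r ^ N) * head x hx - (1 - x * r ^ N) * head y hy)

/-- The general term of a very-well-poised series; the well-poised case is
`b * u = c * v = d * w = a`. -/
noncomputable def vwpTerm (p a b c d u v w z : F) (k : ℕ) : F :=
  (1 - a * p ^ (2 * k)) * (qPoch a p k * qPoch b p k * qPoch c p k * qPoch d p k) /
    (qPoch p p k * qPoch (p * u) p k * qPoch (p * v) p k * qPoch (p * w) p k) * z ^ k

theorem vwpTerm_succ_mul {p a b c d u v w z : F} (hp : ∀ i : ℕ, 1 - p * p ^ i ≠ 0) (j : ℕ) :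
    vwpTerm p a b c d u v w z (j + 1) * ((1 - p ^ (j + 1)) * (1 - a * p ^ (j + 1))) =
      (1 - a) * (1 - a * p) * (1 - b) * (1 - c) * (1 - d) * z /
          ((1 - p * u) * (1 - p * v) * (1 - p * w)) *
        vwpTerm p (a * p ^ 2) (b * p) (c * p) (d * p) (u * p) (v * p) (w * p) z j := by
  have ha : qPoch a p (j + 1) * (1 - a * p ^ (j + 1)) =
      (1 - a) * ((1 - a * p) * qPoch (a * p ^ 2) p j) := by
    rw [← qPoch_succ, qPoch_succ_left, qPoch_succ_left]; ring_nf
  have hp' := qPoch_succ p p j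
  have h1 := hp j
  unfold vwpTerm
  rw [hp', qPoch_succ_left b, qPoch_succ_left c, qPoch_succ_left d, qPoch_succ_left (p * u),
    qPoch_succ_left (p * v), qPoch_succ_left (p * w), mul_assoc p u, mul_assoc p v, mul_assoc p w]
  rw [show p ^ (j + 1) = p * p ^ j from pow_succ' _ _] at ha ⊢
  rw [show a * p ^ 2 * p ^ (2 * j) = a * p ^ (2 * (j + 1)) by ring, pow_succ]
  have hX : (1 - p * p ^ j) * (1 - p * p ^ j)⁻¹ = 1 := mul_inv_cancel₀ h1
  simp only [div_eq_mul_inv, mul_inv]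
  generalize (1 - p * p ^ j)⁻¹ = X at *
  generalize (1 - p * u)⁻¹ = X1
  generalize (1 - p * v)⁻¹ = X2
  generalize (1 - p * w)⁻¹ = X3
  generalize (qPoch p p j)⁻¹ = X4
  generalize (qPoch (p * (u * p)) p j)⁻¹ = X5
  generalize (qPoch (p * (v * p)) p j)⁻¹ = X6
  generalize (qPoch (p * (w * p)) p j)⁻¹ = X7
  generalize qPoch (b * p) p j = Y1
  generalize qPoch (c * p) p j = Y2
  generalize qPoch (d * p) p j = Y3
  generalize qPoch a p (j + 1) = A at *
  generalize qPoch (a * p ^ 2) p j = A' at *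
  generalize a * p ^ (2 * (j + 1)) = E
  linear_combination
    (1 - E) * ((1 - b) * Y1) * ((1 - c) * Y2) * ((1 - d) * Y3) * X1 * X2 * X3 * X4 * X5 * X6 * X7 *
      (z ^ j * z) * (((1 - p * p ^ j) * X) * ha + (1 - a) * (1 - a * p) * A' * hX)

theorem vwpTerm_contiguous {p a b c d u v w z : F} (hd : d ≠ 1) (hdw : d * (p * w) = a)
    (hw : ∀ i : ℕ, 1 - p * w * p ^ i ≠ 0) (k : ℕ) :
    vwpTerm p a b c d u v (w * p) (p * z) k - vwpTerm p a b c (d * p) u v w z k =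
      -(vwpTerm p a b c d u v (w * p) z k * ((1 - p ^ k) * (1 - a * p ^ k))) /
        ((1 - d) * (1 - p * w)) := by
  have hd' : 1 - d ≠ 0 := sub_ne_zero.mpr hd.symm
  have h1 := qPoch_ne_zero hw k
  have h0 := hw 0
  rw [pow_zero, mul_one] at h0
  have eqd : qPoch (d * p) p k = qPoch d p k * (1 - d * p ^ k) / (1 - d) := by
    rw [eq_div_iff hd', ← one_sub_mul_qPoch]; ring
  have eqw : qPoch (p * (w * p)) p k = qPoch (p * w) p k * (1 - p * w * p ^ k) / (1 - p * w) := by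
    rw [eq_div_iff h0, ← one_sub_mul_qPoch, ← mul_assoc]; ring
  have hk := hw k
  unfold vwpTerm
  rw [eqd, eqw, mul_pow, div_eq_mul_inv, div_eq_mul_inv _ (qPoch p p k * _ * _ * _)]
  simp only [mul_inv, div_eq_mul_inv, inv_inv]
  generalize qPoch (p * w) p k = P at *
  generalize (qPoch p p k)⁻¹ = X1
  generalize (qPoch (p * u) p k)⁻¹ = X2
  generalize (qPoch (p * v) p k)⁻¹ = X3
  field_simp
  subst hdw
  ring

theorem vwpTerm_zero (p a b c d u v w z : F) : vwpTerm p a b c d u v w z 0 = 1 - a := by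
  simp [vwpTerm, qPoch_zero]

theorem sum_vwpTerm_mul {p a b c d u v w z : F} (hp : ∀ i : ℕ, 1 - p * p ^ i ≠ 0) (N : ℕ) :
    ∑ k ∈ range (N + 1), vwpTerm p a b c d u v w z k * ((1 - p ^ k) * (1 - a * p ^ k)) =
      (1 - a) * (1 - a * p) * (1 - b) * (1 - c) * (1 - d) * z /
          ((1 - p * u) * (1 - p * v) * (1 - p * w)) *
        ∑ j ∈ range N,
          vwpTerm p (a * p ^ 2) (b * p) (c * p) (d * p) (u * p) (v * p) (w * p) z j := by
  rw [sum_range_succ', pow_zero, sub_self, zero_mul, mul_zero, add_zero, mul_sum]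
  exact sum_congr rfl fun j _ => vwpTerm_succ_mul hp j

theorem qPoch_shift_prod {p a : F} (ha : ∀ i : ℕ, 1 - a * p ^ i ≠ 0) (u v : F) (N : ℕ) :
    (1 - a) * (1 - a * p) * qPoch (a * p ^ 2) p (N + 1) /
        ((1 - p * u) * qPoch (p * (u * p)) p N * ((1 - p * v) * qPoch (p * (v * p)) p N) *
          (1 - p * (a * p ^ (N + 1)))) =
      qPoch a p (N + 2) / (qPoch (p * u) p (N + 1) * qPoch (p * v) p (N + 1)) := by
  have h : (1 - a) * (1 - a * p) * qPoch (a * p ^ 2) p (N + 1) =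
      qPoch a p (N + 2) * (1 - p * (a * p ^ (N + 1))) := by
    rw [show p * (a * p ^ (N + 1)) = a * p ^ (N + 2) by ring, ← qPoch_succ, qPoch_succ_left a,
      qPoch_succ_left (a * p), mul_assoc a p p, ← pow_two, mul_assoc (1 - a)]
  have h0 : 1 - p * (a * p ^ (N + 1)) ≠ 0 := by
    have := ha (N + 2); convert this using 2; ring
  rw [← mul_assoc p u, ← mul_assoc p v, ← qPoch_succ_left, ← qPoch_succ_left, h,
    mul_div_mul_right _ _ h0]

theorem sum_vwpTerm_mul_of_shifted {p a b c u v : F} (hp0 : p ≠ 0)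
    (hp : ∀ i : ℕ, 1 - p * p ^ i ≠ 0) (ha0 : a ≠ 0) (ha : ∀ i : ℕ, 1 - a * p ^ i ≠ 0) {N : ℕ}
    (h : ∑ k ∈ range (N + 1), vwpTerm p (a * p ^ 2) (b * p) (c * p) (p ^ N)⁻¹ (u * p) (v * p)
          (a * p ^ 2 * p ^ N) (p ^ (N + 1) * (u * p * (v * p) / (a * p ^ 2))) k =
        qPoch (a * p ^ 2) p (N + 1) * qPoch (p * (u * p * (v * p) / (a * p ^ 2))) p N /
          (qPoch (p * (u * p)) p N * qPoch (p * (v * p)) p N)) :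
    ∑ k ∈ range (N + 2), vwpTerm p a b c (p ^ (N + 1))⁻¹ u v (a * p ^ (N + 1))
          (p ^ (N + 1) * (u * v / a)) k * ((1 - p ^ k) * (1 - a * p ^ k)) =
      (1 - b) * (1 - c) * (1 - (p ^ (N + 1))⁻¹) * (p ^ (N + 1) * (u * v / a)) *
        (qPoch a p (N + 2) * qPoch (p * (u * v / a)) p N /
          (qPoch (p * u) p (N + 1) * qPoch (p * v) p (N + 1))) := by
  have hd : (p ^ (N + 1))⁻¹ * p = (p ^ N)⁻¹ := by rw [pow_succ]; field_simp
  rw [show u * p * (v * p) / (a * p ^ 2) = u * v / a by field_simp] at h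
  rw [sum_vwpTerm_mul hp (N + 1), hd, show a * p ^ (N + 1) * p = a * p ^ 2 * p ^ N by ring, h,
    mul_div_right_comm (qPoch a p (N + 2)), ← qPoch_shift_prod ha u v N]
  simp only [div_eq_mul_inv, mul_inv]
  ring

/-- The terminating very-well-poised `₆φ₅` summation. -/
theorem sum_vwpTerm {p : F} (hp0 : p ≠ 0) (hp : ∀ i : ℕ, 1 - p * p ^ i ≠ 0) (N : ℕ) :
    ∀ {a b c u v : F}, a ≠ 0 → b * u = a → c * v = a →
    (∀ i : ℕ, 1 - a * p ^ i ≠ 0) → (∀ i : ℕ, 1 - p * u * p ^ i ≠ 0) →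
    (∀ i : ℕ, 1 - p * v * p ^ i ≠ 0) →
    ∑ k ∈ range (N + 1),
        vwpTerm p a b c (p ^ N)⁻¹ u v (a * p ^ N) (p ^ (N + 1) * (u * v / a)) k =
      qPoch a p (N + 1) * qPoch (p * (u * v / a)) p N /
        (qPoch (p * u) p N * qPoch (p * v) p N) := by
  induction N with
  | zero =>
    intro a b c u v _ _ _ _ _ _
    simp [vwpTerm_zero, qPoch_zero, qPoch_succ]
  | succ N ih =>
    intro a b c u v ha0 hbu hcv ha hu hv
    have hd1 : (p ^ (N + 1))⁻¹ ≠ 1 := fun h => hp N <| by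
      rw [inv_eq_one] at h; rw [← pow_succ', h, sub_self]
    have hw (M : ℕ) (i : ℕ) : 1 - p * (a * p ^ M) * p ^ i ≠ 0 := by
      have := ha (M + i + 1); convert this using 2; ring
    have hd2 : (p ^ (N + 1))⁻¹ * p = (p ^ N)⁻¹ := by rw [pow_succ]; field_simp
    have contig (k : ℕ) := vwpTerm_contiguous (b := b) (c := c) (u := u) (v := v)
      (z := p ^ (N + 1) * (u * v / a)) hd1
      (show (p ^ (N + 1))⁻¹ * (p * (a * p ^ N)) = a by rw [pow_succ]; field_simp) (hw N) k
    simp only [hd2, mul_assoc a, ← pow_succ, ← mul_assoc p (p ^ _), ← pow_succ'] at contig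
    have hlast :
        vwpTerm p a b c (p ^ N)⁻¹ u v (a * p ^ N) (p ^ (N + 1) * (u * v / a)) (N + 1) = 0 := by
      simp [vwpTerm, qPoch_inv_pow_succ_self hp0]
    have hS := ih ha0 hbu hcv ha hu hv
    have shift {t : F} (ht : ∀ i : ℕ, 1 - p * t * p ^ i ≠ 0) (i : ℕ) :
        1 - p * (t * p) * p ^ i ≠ 0 := by
      have := ht (i + 1); convert this using 2; ring
    have hS' := ih (a := a * p ^ 2) (b := b * p) (c := c * p) (u := u * p) (v := v * p)
      (mul_ne_zero ha0 (pow_ne_zero _ hp0)) (by rw [← hbu]; ring) (by rw [← hcv]; ring)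
      (fun i => by have := ha (i + 2); convert this using 2; ring) (shift hu) (shift hv)
    have hM := sum_vwpTerm_mul_of_shifted hp0 hp ha0 ha hS'
    have hsum := sum_congr (s₁ := range (N + 2)) rfl fun k _ => contig k
    rw [sum_sub_distrib, ← sum_div, sum_neg_distrib, hM,
      sum_range_succ (vwpTerm p a b c (p ^ N)⁻¹ u v (a * p ^ N) _) (N + 1), hlast,
      add_zero, hS, sub_eq_iff_eq_add] at hsum
    rw [hsum, qPoch_succ a p (N + 1), qPoch_succ (p * u), qPoch_succ (p * v),
      qPoch_succ (p * (u * v / a))]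
    clear hsum hM hS hS' hlast contig ih hd2 shift
    have h1 := qPoch_ne_zero hu N
    have h2 := qPoch_ne_zero hv N
    have h3 := hu N
    have h4 := hv N
    have h5 := hw N 0
    have h6 : 1 - (p ^ (N + 1))⁻¹ ≠ 0 := sub_ne_zero.mpr hd1.symm
    rw [pow_zero, mul_one] at h5
    generalize 1 - (p ^ (N + 1))⁻¹ = D at *
    have h7 : 1 - a * p ^ (N + 1) = 1 - p * (a * p ^ N) := by ring
    have hzu : c * (u * v / a) = u := by
      rw [← hcv] at ha0 ⊢
      have := right_ne_zero_of_mul ha0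
      have := left_ne_zero_of_mul ha0
      field_simp
    have hzv : b * (u * v / a) = v := by
      rw [← hbu] at ha0 ⊢
      have := right_ne_zero_of_mul ha0
      have := left_ne_zero_of_mul ha0
      field_simp
    have hzuv : a * (u * v / a) = u * v := by field_simp
    have hzbc : b * c * (u * v / a) = a := by rw [mul_right_comm, hzv, mul_comm, hcv]
    rw [h7]
    generalize qPoch (p * (u * v / a)) p N = Z
    generalize u * v / a = t at *
    generalize qPoch (p * u) p N = U at *
    generalize qPoch (p * v) p N = V at *
    generalize qPoch a p (N + 1) = A at *
    rw [pow_succ']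
    generalize p ^ N = P at *
    have key : (1 - p * (a * P)) * (1 - p * t * P) =
        (1 - p * u * P) * (1 - p * v * P) - (1 - b) * (1 - c) * (p * P * t) := by
      linear_combination p * P * (p * P * hzuv - hzu - hzv + hzbc)
    have e : -((1 - b) * (1 - c) * D * (p * P * t) *
        (A * (1 - p * (a * P)) * Z / (U * (1 - p * u * P) * (V * (1 - p * v * P))))) /
          (D * (1 - p * (a * P))) =
        -((1 - b) * (1 - c) * (p * P * t)) *
          (A * Z / (U * (1 - p * u * P) * (V * (1 - p * v * P)))) := by
      generalize 1 - p * (a * P) = X at *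
      generalize 1 - p * u * P = X1 at *
      generalize 1 - p * v * P = X2 at *
      field_simp
    have e' : A * Z / (U * V) = (1 - p * u * P) * (1 - p * v * P) *
        (A * Z / (U * (1 - p * u * P) * (V * (1 - p * v * P)))) := by
      generalize 1 - p * u * P = X1 at *
      generalize 1 - p * v * P = X2 at *
      field_simp
    rw [e, e']
    linear_combination -(A * Z / (U * (1 - p * u * P) * (V * (1 - p * v * P)))) * key

theorem sum_vwpTerm_mul_eq {p a b c u v : F} (hp0 : p ≠ 0)
    (hp : ∀ i : ℕ, 1 - p * p ^ i ≠ 0) (ha0 : a ≠ 0) (hbu : b * u = a) (hcv : c * v = a)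
    (ha : ∀ i : ℕ, 1 - a * p ^ i ≠ 0) (hu : ∀ i : ℕ, 1 - p * u * p ^ i ≠ 0)
    (hv : ∀ i : ℕ, 1 - p * v * p ^ i ≠ 0) (N : ℕ) :
    (∑ k ∈ range (N + 1), vwpTerm p a b c (p ^ N)⁻¹ u v (a * p ^ N) (p ^ N * (u * v / a)) k *
        ((1 - p ^ k) * (1 - a * p ^ k))) * (1 - p ^ N * (u * v / a)) =
      (1 - b) * (1 - c) * (1 - (p ^ N)⁻¹) * (p ^ N * (u * v / a)) *
        (qPoch a p (N + 1) * qPoch (p * (u * v / a)) p N /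
          (qPoch (p * u) p N * qPoch (p * v) p N)) := by
  cases N with
  | zero => simp
  | succ N =>
    have shift {t : F} (ht : ∀ i : ℕ, 1 - p * t * p ^ i ≠ 0) (i : ℕ) :
        1 - p * (t * p) * p ^ i ≠ 0 := by
      have := ht (i + 1); convert this using 2; ring
    have hS' := sum_vwpTerm hp0 hp N (a := a * p ^ 2) (b := b * p) (c := c * p) (u := u * p)
      (v := v * p) (mul_ne_zero ha0 (pow_ne_zero _ hp0)) (by rw [← hbu]; ring)
      (by rw [← hcv]; ring)
      (fun i => by have := ha (i + 2); convert this using 2; ring) (shift hu) (shift hv)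
    rw [sum_vwpTerm_mul_of_shifted hp0 hp ha0 ha hS', qPoch_succ (p * (u * v / a))]
    ring

theorem sum_qInt_qPoch {q : F} (hq0 : q ≠ 0) (hq : Function.Injective fun m : ℕ => q ^ m)
    (N : ℕ) :
    ∑ k ∈ range (N + 1), (1 - q ^ 2 * (q ^ 8) ^ (2 * k)) / (1 - q ^ 2) *
        ((1 - q * (q ^ 8) ^ k) / (1 - q)) ^ 2 *
        (qPoch (q ^ 2) (q ^ 8) k ^ 2 * qPoch (q ^ 4 * (q ^ 8) ^ N) (q ^ 8) k *
          qPoch ((q ^ 8) ^ N)⁻¹ (q ^ 8) k) /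
        (qPoch (q ^ 8) (q ^ 8) k ^ 2 * qPoch (q ^ 8 * (q ^ 2 * (q ^ 8) ^ N)) (q ^ 8) k *
          qPoch (q ^ 8 * (q ^ 2 * (q ^ 8) ^ N)⁻¹) (q ^ 8) k) * (q ^ 4)⁻¹ ^ k =
      (1 - q ^ 2 * (q ^ 8) ^ N) / (1 - q ^ 2) * qPoch (q ^ 4) (q ^ 8) N /
          qPoch (q ^ 8) (q ^ 8) N * (q ^ 2)⁻¹ ^ N *
        (1 - (1 - q ^ 4 * (q ^ 8) ^ N) * (1 - ((q ^ 8) ^ N)⁻¹) / ((1 - q) ^ 2 * (1 + q ^ 2))) := by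
  have one_sub_pow (m : ℕ) (hm : m ≠ 0) : 1 - q ^ m ≠ 0 :=
    sub_ne_zero.mpr fun h => hm (hq (by simpa using h.symm))
  have hp0 : q ^ 8 ≠ 0 := pow_ne_zero _ hq0
  have ha0 : q ^ 2 ≠ 0 := pow_ne_zero _ hq0
  have hp (i : ℕ) : 1 - q ^ 8 * (q ^ 8) ^ i ≠ 0 := by
    convert one_sub_pow (8 + 8 * i) (by omega) using 2; ring
  have ha (i : ℕ) : 1 - q ^ 2 * (q ^ 8) ^ i ≠ 0 := by
    convert one_sub_pow (2 + 8 * i) (by omega) using 2; ring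
  have hu (i : ℕ) : 1 - q ^ 8 * 1 * (q ^ 8) ^ i ≠ 0 := by rw [mul_one]; exact hp i
  have hv (i : ℕ) : 1 - q ^ 8 * (q ^ 2 * (q ^ 8) ^ N)⁻¹ * (q ^ 8) ^ i ≠ 0 := by
    intro h
    have hx : q ^ 2 * (q ^ 8) ^ N * (q ^ 2 * (q ^ 8) ^ N)⁻¹ = 1 :=
      mul_inv_cancel₀ (mul_ne_zero ha0 (pow_ne_zero _ hp0))
    have h' : q ^ (2 + 8 * N) = q ^ (8 + 8 * i) := by
      rw [pow_add, pow_add, pow_mul, pow_mul]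
      linear_combination q ^ 2 * (q ^ 8) ^ N * h + q ^ 8 * (q ^ 8) ^ i * hx
    have := hq h'
    omega
  have hcv : q ^ 4 * (q ^ 8) ^ N * (q ^ 2 * (q ^ 8) ^ N)⁻¹ = q ^ 2 := by field_simp
  have ht : 1 * (q ^ 2 * (q ^ 8) ^ N)⁻¹ / q ^ 2 = (q ^ 4 * (q ^ 8) ^ N)⁻¹ := by field_simp
  have hz : (q ^ 8) ^ N * (q ^ 4 * (q ^ 8) ^ N)⁻¹ = (q ^ 4)⁻¹ := by field_simp
  have hz' : (q ^ 8) ^ (N + 1) * (q ^ 4 * (q ^ 8) ^ N)⁻¹ = (q ^ 4)⁻¹ * q ^ 8 := by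
    rw [← hz]; ring
  have hS := sum_vwpTerm hp0 hp N ha0 (mul_one _) hcv ha hu hv
  have hM := sum_vwpTerm_mul_eq hp0 hp ha0 (mul_one _) hcv ha hu hv N
  rw [ht, hz', mul_one (q ^ 8)] at hS
  rw [ht, hz, mul_one (q ^ 8)] at hM
  set A := qPoch (q ^ 2) (q ^ 8) (N + 1) * qPoch (q ^ 8 * (q ^ 4 * (q ^ 8) ^ N)⁻¹) (q ^ 8) N /
    (qPoch (q ^ 8) (q ^ 8) N * qPoch (q ^ 8 * (q ^ 2 * (q ^ 8) ^ N)⁻¹) (q ^ 8) N) with hA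
  have hA' : A = (1 - q ^ 2 * (q ^ 8) ^ N) * (qPoch (q ^ 4) (q ^ 8) N / qPoch (q ^ 8) (q ^ 8) N) *
      (q ^ 2)⁻¹ ^ N := by
    have hrev := qPoch_reverse hp0 (pow_ne_zero 4 hq0) ha0 N
    have h1 := qPoch_ne_zero hp N
    have h2 := qPoch_ne_zero hv N
    have h3 : (q ^ 2) ^ N ≠ 0 := pow_ne_zero _ ha0
    rw [show (q ^ 4) ^ N = (q ^ 2) ^ N * (q ^ 2) ^ N by ring] at hrev
    rw [hA, inv_pow, qPoch_succ]
    clear hA hS hM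
    generalize qPoch (q ^ 8 * (q ^ 4 * (q ^ 8) ^ N)⁻¹) (q ^ 8) N = Z at *
    generalize qPoch (q ^ 8 * (q ^ 2 * (q ^ 8) ^ N)⁻¹) (q ^ 8) N = V at *
    generalize qPoch (q ^ 8) (q ^ 8) N = P at *
    generalize (q ^ 2) ^ N = R at *
    have hrev' : Z * R * qPoch (q ^ 2) (q ^ 8) N = qPoch (q ^ 4) (q ^ 8) N * V :=
      mul_right_cancel₀ h3 (by linear_combination hrev)
    rw [← div_eq_mul_inv, ← mul_div_assoc, div_div,
      div_eq_div_iff (mul_ne_zero h1 h2) (mul_ne_zero h1 h3)]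
    linear_combination (1 - q ^ 2 * (q ^ 8) ^ N) * P * hrev'
  have hq1 : 1 - q ≠ 0 := by simpa using one_sub_pow 1 one_ne_zero
  have hq2 := one_sub_pow 2 two_ne_zero
  have hq4 := one_sub_pow 4 four_ne_zero
  have hq4' : 1 + q ^ 2 ≠ 0 := fun h => hq4 (by linear_combination (1 - q ^ 2) * h)
  have hM' : ∑ k ∈ range (N + 1), vwpTerm (q ^ 8) (q ^ 2) (q ^ 2) (q ^ 4 * (q ^ 8) ^ N)
      ((q ^ 8) ^ N)⁻¹ 1 (q ^ 2 * (q ^ 8) ^ N)⁻¹ (q ^ 2 * (q ^ 8) ^ N) (q ^ 4)⁻¹ k *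
        ((1 - (q ^ 8) ^ k) * (1 - q ^ 2 * (q ^ 8) ^ k)) =
      -((1 - q ^ 4 * (q ^ 8) ^ N) * (1 - ((q ^ 8) ^ N)⁻¹) / (1 + q ^ 2) * A) := by
    have hX : (q ^ 4)⁻¹ * q ^ 4 = 1 := inv_mul_cancel₀ (pow_ne_zero 4 hq0)
    have h1 : 1 - (q ^ 4)⁻¹ ≠ 0 := fun h => hq4 (by linear_combination - hX - q ^ 4 * h)
    refine mul_right_cancel₀ h1 (hM.trans ?_)
    generalize 1 - q ^ 4 * (q ^ 8) ^ N = C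
    generalize 1 - ((q ^ 8) ^ N)⁻¹ = D
    clear_value A
    field_simp
    ring
  have hterm (k : ℕ) : (1 - q ^ 2 * (q ^ 8) ^ (2 * k)) / (1 - q ^ 2) *
        ((1 - q * (q ^ 8) ^ k) / (1 - q)) ^ 2 *
        (qPoch (q ^ 2) (q ^ 8) k ^ 2 * qPoch (q ^ 4 * (q ^ 8) ^ N) (q ^ 8) k *
          qPoch ((q ^ 8) ^ N)⁻¹ (q ^ 8) k) /
        (qPoch (q ^ 8) (q ^ 8) k ^ 2 * qPoch (q ^ 8 * (q ^ 2 * (q ^ 8) ^ N)) (q ^ 8) k *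
          qPoch (q ^ 8 * (q ^ 2 * (q ^ 8) ^ N)⁻¹) (q ^ 8) k) * (q ^ 4)⁻¹ ^ k =
      ((1 - q) ^ 2 * vwpTerm (q ^ 8) (q ^ 2) (q ^ 2) (q ^ 4 * (q ^ 8) ^ N)
        ((q ^ 8) ^ N)⁻¹ 1 (q ^ 2 * (q ^ 8) ^ N)⁻¹ (q ^ 2 * (q ^ 8) ^ N) ((q ^ 4)⁻¹ * q ^ 8) k +
      vwpTerm (q ^ 8) (q ^ 2) (q ^ 2) (q ^ 4 * (q ^ 8) ^ N)
        ((q ^ 8) ^ N)⁻¹ 1 (q ^ 2 * (q ^ 8) ^ N)⁻¹ (q ^ 2 * (q ^ 8) ^ N) (q ^ 4)⁻¹ k *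
        ((1 - (q ^ 8) ^ k) * (1 - q ^ 2 * (q ^ 8) ^ k))) / ((1 - q ^ 2) * (1 - q) ^ 2) := by
    unfold vwpTerm
    rw [mul_one (q ^ 8), mul_pow (q ^ 4)⁻¹]
    generalize qPoch ((q ^ 8) ^ N)⁻¹ (q ^ 8) k = Y1
    generalize qPoch (q ^ 8 * (q ^ 2 * (q ^ 8) ^ N)⁻¹) (q ^ 8) k = Y2
    generalize qPoch (q ^ 8 * (q ^ 2 * (q ^ 8) ^ N)) (q ^ 8) k = Y3
    generalize qPoch (q ^ 4 * (q ^ 8) ^ N) (q ^ 8) k = Y4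
    generalize (q ^ 4)⁻¹ ^ k = Y5
    generalize qPoch (q ^ 8) (q ^ 8) k = Y6
    generalize qPoch (q ^ 2) (q ^ 8) k = Y7
    generalize (q ^ 8) ^ (2 * k) = Y8
    generalize (q ^ 8) ^ k = Y9
    simp only [div_eq_mul_inv, mul_inv, mul_pow, ← inv_pow]
    generalize (1 - q ^ 2)⁻¹ = X1
    generalize (1 - q)⁻¹ = X2
    ring
  simp only [hterm]
  rw [← sum_div, sum_add_distrib, ← mul_sum, hS, hM', hA']
  simp only [mul_div_assoc (_ / _)]
  generalize qPoch (q ^ 4) (q ^ 8) N / qPoch (q ^ 8) (q ^ 8) N = R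
  generalize 1 - q ^ 4 * (q ^ 8) ^ N = C
  generalize 1 - ((q ^ 8) ^ N)⁻¹ = D
  generalize (q ^ 2)⁻¹ ^ N = E
  field_simp
  ring

end QPoch

/-- The terminating Watson `₈φ₇` evaluation used in the proof of Theorem 2:
the sum of Theorem 4 with `a = q^(2n)` (equivalently `a = q^(-2n)`) substituted. -/
theorem stmt17 (n : ℕ) (hn : 0 < n) (hn4 : n % 4 = 1) :
    let q : RatFunc ℚ := RatFunc.X
    (∑ k ∈ Finset.range ((n - 1) / 4 + 1),
        qInt (q ^ 2) (8 * (k : ℤ) + 1) * qInt q (8 * (k : ℤ) + 1) ^ 2 *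
          (qPoch (q ^ 2) (q ^ 8) k ^ 2 * qPoch (q ^ (2 + 2 * (n : ℤ))) (q ^ 8) k *
            qPoch (q ^ (2 - 2 * (n : ℤ))) (q ^ 8) k) /
          (qPoch (q ^ 8) (q ^ 8) k ^ 2 * qPoch (q ^ (8 + 2 * (n : ℤ))) (q ^ 8) k *
            qPoch (q ^ (8 - 2 * (n : ℤ))) (q ^ 8) k) * q ^ (-4 * (k : ℤ))) =
      qInt (q ^ 2) (n : ℤ) * qPoch (q ^ 4) (q ^ 8) ((n - 1) / 4) /
          qPoch (q ^ 8) (q ^ 8) ((n - 1) / 4) * q ^ (-(((n : ℤ) - 1) / 2)) *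
        (1 - (1 - q ^ (2 + 2 * (n : ℤ))) * (1 - q ^ (2 - 2 * (n : ℤ))) /
          ((1 - q) ^ 2 * (1 + q ^ 2))) := by
  intro q
  have hq0 : q ≠ 0 := RatFunc.X_ne_zero
  have hq : Function.Injective fun m : ℕ => q ^ m := by
    intro m k h
    have h' : algebraMap ℚ[X] (RatFunc ℚ) (X ^ m) = algebraMap ℚ[X] (RatFunc ℚ) (X ^ k) := by
      simpa only [map_pow, RatFunc.algebraMap_X] using h
    simpa using congrArg natDegree (RatFunc.algebraMap_injective ℚ h')
  clear_value q
  obtain ⟨N, rfl⟩ : ∃ N, n = 4 * N + 1 := ⟨n / 4, by omega⟩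
  have hN : (4 * N + 1 - 1) / 4 = N := by omega
  have key {x : ℤ} (i j : ℕ) (h : x = i - j) : q ^ x = q ^ i * (q ^ j)⁻¹ := by
    rw [h, zpow_sub₀ hq0, zpow_natCast, zpow_natCast, div_eq_mul_inv]
  have e1 : q ^ (2 + 2 * ((4 * N + 1 : ℕ) : ℤ)) = q ^ 4 * (q ^ 8) ^ N := by
    rw [key (4 + 8 * N) 0 (by push_cast; ring)]; ring
  have e2 : q ^ (2 - 2 * ((4 * N + 1 : ℕ) : ℤ)) = ((q ^ 8) ^ N)⁻¹ := by
    rw [key 0 (8 * N) (by push_cast; ring), pow_mul]; ring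
  have e3 : q ^ (8 + 2 * ((4 * N + 1 : ℕ) : ℤ)) = q ^ 8 * (q ^ 2 * (q ^ 8) ^ N) := by
    rw [key (10 + 8 * N) 0 (by push_cast; ring)]; ring
  have e4 : q ^ (8 - 2 * ((4 * N + 1 : ℕ) : ℤ)) = q ^ 8 * (q ^ 2 * (q ^ 8) ^ N)⁻¹ := by
    rw [key 8 (2 + 8 * N) (by push_cast; ring), pow_add, pow_mul]
  have e5 (k : ℕ) : q ^ (-4 * (k : ℤ)) = (q ^ 4)⁻¹ ^ k := by
    rw [key 0 (4 * k) (by push_cast; ring), pow_mul, inv_pow]; ring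
  have e6 : q ^ (-((((4 * N + 1 : ℕ) : ℤ) - 1) / 2)) = (q ^ 2)⁻¹ ^ N := by
    rw [key 0 (2 * N) (by push_cast; omega), pow_mul, inv_pow]; ring
  have e7 (k : ℕ) : qInt (q ^ 2) (8 * (k : ℤ) + 1) =
      (1 - q ^ 2 * (q ^ 8) ^ (2 * k)) / (1 - q ^ 2) := by
    rw [qInt, show (8 * (k : ℤ) + 1) = ((8 * k + 1 : ℕ) : ℤ) by push_cast; ring, zpow_natCast]
    ring_nf
  have e8 (k : ℕ) : qInt q (8 * (k : ℤ) + 1) = (1 - q * (q ^ 8) ^ k) / (1 - q) := by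
    rw [qInt, show (8 * (k : ℤ) + 1) = ((8 * k + 1 : ℕ) : ℤ) by push_cast; ring, zpow_natCast]
    ring_nf
  have e9 : qInt (q ^ 2) ((4 * N + 1 : ℕ) : ℤ) = (1 - q ^ 2 * (q ^ 8) ^ N) / (1 - q ^ 2) := by
    rw [qInt, zpow_natCast]
    ring_nf
  simp only [hN, e1, e2, e3, e4, e5, e6, e7, e8, e9]
  exact sum_qInt_qPoch hq0 hq N
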